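/- arXiv:2512.04531 — 2 statements merged into one kernel-verified Lean document; each statement's English description precedes it below -/
import Mathlib

section
/- Let G be a countable group with Kazhdan's property (T), G ↷ (X,μ) a pmp action, H a countable group, and c : G × X → H an amenable cocycle. Then c is essentially trivial, i.e. there exists a Borel map φ : X → F(H) into finite nonempty subsets of H with φ(gx) = c(g,x)φ(x) for every g ∈ G and a.e. x ∈ X. -/
open MeasureTheory Filter Topology

/-- `ℓ¹` probability vectors on `H` (the space `P(H)`). -/
def IsProbVec {H : Type*} (p : H → ℝ) : Prop :=
  (∀ h, 0 ≤ p h) ∧ ∑' h, p h = 1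

/-- The `ℓ¹` distance between two vectors. -/
noncomputable def l1dist {H : Type*} (p q : H → ℝ) : ℝ := ∑' h, |p h - q h|

/-- The left translation action of `H` on `ℓ¹(H)`. -/
def lshift {H : Type*} [Group H] (h : H) (p : H → ℝ) : H → ℝ := fun k => p (h⁻¹ * k)

/-- A cocycle `c` for an action `σ` of `Γ` on `(X, μ)`, with values in a countable group `H`,
is *amenable* if there are Borel maps `φₙ : X → P(H)` with
`‖φₙ(gx) − c(g,x)·φₙ(x)‖₁ → 0` for every `g ∈ Γ` and a.e. `x ∈ X`. -/
def AmenableCocycle {Γ H X : Type*} [Group H] [MeasurableSpace X]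
    (μ : Measure X) (σ : Γ → X → X) (c : Γ → X → H) : Prop :=
  ∃ φ : ℕ → X → H → ℝ,
    (∀ n h, Measurable fun x => φ n x h) ∧
    (∀ n x, IsProbVec (φ n x)) ∧
    ∀ g : Γ, ∀ᵐ x ∂μ,
      Tendsto (fun n => l1dist (φ n (σ g x)) (lshift (c g x) (φ n x))) atTop (𝓝 0)

/-- A cocycle `c` for an action `σ` of `Γ` on `(X, μ)` is *essentially trivial* if there is a
Borel map `φ : X → F(H)` into finite nonempty subsets of `H` with `φ(gx) = c(g,x)·φ(x)`
for every `g ∈ Γ` and a.e. `x ∈ X`. -/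
def EssTrivialCocycle {Γ H X : Type*} [Group H] [MeasurableSpace X]
    (μ : Measure X) (σ : Γ → X → X) (c : Γ → X → H) : Prop :=
  ∃ φ : X → Finset H,
    (∀ F : Finset H, MeasurableSet {x | φ x = F}) ∧
    (∀ x, (φ x).Nonempty) ∧
    ∀ g : Γ, ∀ᵐ x ∂μ, (φ (σ g x) : Set H) = (fun h => c g x * h) '' (φ x : Set H)
/-- Kazhdan's property (T): every unitary representation of `G` (on a complex Hilbert space)
with almost invariant unit vectors has a nonzero invariant vector. -/
def HasPropertyT (G : Type*) [Group G] : Prop :=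
  ∀ (E : Type) (_ : NormedAddCommGroup E) (_ : InnerProductSpace ℂ E) (_ : CompleteSpace E)
    (π : G →* (E ≃ₗᵢ[ℂ] E)),
    (∀ (F : Finset G) (ε : ℝ), 0 < ε → ∃ v : E, ‖v‖ = 1 ∧ ∀ g ∈ F, ‖π g v - v‖ < ε) →
    ∃ v : E, v ≠ 0 ∧ ∀ g : G, π g v = v

section UnitaryRepresentations

/-- A multiplicative family of linear isometries indexed by a group, as a unitary
representation. -/
def unitaryRepOfIsometries {G E : Type*} [Group G] [NormedAddCommGroup E]
    [InnerProductSpace ℂ E] (T : G → E →ₗᵢ[ℂ] E) (h_one : ∀ v, T 1 v = v)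
    (h_mul : ∀ g h v, T (g * h) v = T g (T h v)) : G →* (E ≃ₗᵢ[ℂ] E) where
  toFun g :=
    { toLinearEquiv := LinearEquiv.ofLinearMap (T g).toLinearMap (T g⁻¹).toLinearMap
        (by ext v; simp [← h_mul, h_one]) (by ext v; simp [← h_mul, h_one])
      norm_map' := fun v => (T g).norm_map v }
  map_one' := by ext v; exact h_one v
  map_mul' g h := by ext v; exact h_mul g h v

@[simp]
lemma unitaryRepOfIsometries_apply {G E : Type*} [Group G] [NormedAddCommGroup E]
    [InnerProductSpace ℂ E] (T : G → E →ₗᵢ[ℂ] E) (h_one : ∀ v, T 1 v = v)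
    (h_mul : ∀ g h v, T (g * h) v = T g (T h v)) (g : G) (v : E) :
    unitaryRepOfIsometries T h_one h_mul g v = T g v := rfl

/-- The restriction of a unitary representation to an invariant subspace. -/
noncomputable def unitarySubrep {G E : Type*} [Group G] [NormedAddCommGroup E]
    [InnerProductSpace ℂ E] (π : G →* (E ≃ₗᵢ[ℂ] E)) (S : Submodule ℂ E) (hS : ∀ g, ∀ v ∈ S, π g v ∈ S) :
    G →* (S ≃ₗᵢ[ℂ] S) :=
  unitaryRepOfIsometries
    (fun g =>
      { toLinearMap := (π g).toLinearEquiv.toLinearMap.restrict (hS g)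
        norm_map' := fun v => (π g).norm_map v })
    (fun v => Subtype.ext (by change π 1 (v : E) = v; simp))
    (fun g h v => Subtype.ext (by change π (g * h) (v : E) = π g (π h v); simp))

@[simp]
lemma coe_unitarySubrep_apply {G E : Type*} [Group G] [NormedAddCommGroup E]
    [InnerProductSpace ℂ E] (π : G →* (E ≃ₗᵢ[ℂ] E)) (S : Submodule ℂ E)
    (hS : ∀ g, ∀ v ∈ S, π g v ∈ S) (g : G) (v : S) :
    (unitarySubrep π S hS g v : E) = π g v := rfl

/-- An orthonormal family in a separable inner product space is countable. -/
lemma Orthonormal.countable_of_separableSpace {ι E : Type*} [NormedAddCommGroup E]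
    [InnerProductSpace ℂ E] [TopologicalSpace.SeparableSpace E] {v : ι → E}
    (hv : Orthonormal ℂ v) : Countable ι := by
  refine Pairwise.countable_of_isOpen_disjoint (s := fun i => Metric.ball (v i) (1 / 2))
    ?_ (fun i => Metric.isOpen_ball) (fun i => ⟨v i, Metric.mem_ball_self (by norm_num)⟩)
  intro i j hij
  refine Metric.ball_disjoint_ball ?_
  have h : ‖v i - v j‖ * ‖v i - v j‖ = 1 * 1 + 1 * 1 := by
    rw [sub_eq_add_neg, norm_add_sq_eq_norm_sq_add_norm_sq_of_inner_eq_zero (𝕜 := ℂ)]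
    · rw [norm_neg, hv.1 j, hv.1 i]
    · rw [inner_neg_right, hv.2 hij, neg_zero]
  rw [dist_eq_norm]
  nlinarith [norm_nonneg (v i - v j)]

/-- A separable Hilbert space is isometric to one in the lowest universe. -/
lemma exists_linearIsometryEquiv_lp_of_separableSpace (E : Type*) [NormedAddCommGroup E]
    [InnerProductSpace ℂ E] [CompleteSpace E] [TopologicalSpace.SeparableSpace E] :
    ∃ ι : Type, Nonempty (E ≃ₗᵢ[ℂ] lp (fun _ : ι => ℂ) 2) := by
  obtain ⟨w, b, -⟩ := exists_hilbertBasis ℂ E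
  have hw : Countable w := b.orthonormal.countable_of_separableSpace
  obtain ⟨f, hf⟩ := exists_injective_nat w
  let e : Set.range f ≃ w := (Equiv.ofInjective f hf).symm
  refine ⟨Set.range f, ⟨(HilbertBasis.mk (v := b ∘ e) (b.orthonormal.comp e e.injective) ?_).repr⟩⟩
  rw [e.surjective.range_comp, b.dense_span]

/-- Property (T) for separable Hilbert spaces in an arbitrary universe. -/
lemma HasPropertyT.exists_invariant_of_separableSpace {G E : Type*} [Group G]
    [NormedAddCommGroup E] [InnerProductSpace ℂ E] [CompleteSpace E]
    [TopologicalSpace.SeparableSpace E] (hT : HasPropertyT G) (π : G →* (E ≃ₗᵢ[ℂ] E))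
    (hπ : ∀ (F : Finset G) (ε : ℝ), 0 < ε → ∃ v : E, ‖v‖ = 1 ∧ ∀ g ∈ F, ‖π g v - v‖ < ε) :
    ∃ v : E, v ≠ 0 ∧ ∀ g : G, π g v = v := by
  obtain ⟨ι, ⟨J⟩⟩ := exists_linearIsometryEquiv_lp_of_separableSpace E
  obtain ⟨v, hv, hinv⟩ := hT (lp (fun _ : ι => ℂ) 2) inferInstance inferInstance inferInstance
    (unitaryRepOfIsometries
      (fun g => J.toLinearIsometry.comp ((π g).toLinearIsometry.comp J.symm.toLinearIsometry))
      (fun v => by simp) (fun g h v => by simp))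
    (fun F ε hε => by
      obtain ⟨v, hv, hF⟩ := hπ F ε hε
      refine ⟨J v, by simpa using hv, fun g hg => ?_⟩
      simpa [← map_sub] using hF g hg)
  refine ⟨J.symm v, by simpa using hv, fun g => J.injective ?_⟩
  simpa using hinv g

/-- Property (T) of a countable group, for Hilbert spaces in an arbitrary universe. -/
lemma HasPropertyT.exists_invariant {G E : Type*} [Group G] [Countable G]
    [NormedAddCommGroup E] [InnerProductSpace ℂ E] [CompleteSpace E]
    (hT : HasPropertyT G) (π : G →* (E ≃ₗᵢ[ℂ] E))
    (hπ : ∀ (F : Finset G) (ε : ℝ), 0 < ε → ∃ v : E, ‖v‖ = 1 ∧ ∀ g ∈ F, ‖π g v - v‖ < ε) :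
    ∃ v : E, v ≠ 0 ∧ ∀ g : G, π g v = v := by
  choose u hu_norm hu using fun (F : Finset G) (n : ℕ) =>
    hπ F (1 / ((n : ℝ) + 1)) Nat.one_div_pos_of_nat
  let s : Set E := Set.range fun p : G × Finset G × ℕ => π p.1 (u p.2.1 p.2.2)
  let S : Submodule ℂ E := (Submodule.span ℂ s).topologicalClosure
  have hsS : s ⊆ S := Submodule.subset_span.trans (Submodule.le_topologicalClosure _)
  have hS : ∀ g, ∀ v ∈ S, π g v ∈ S := by
    intro g
    have hspan : Submodule.span ℂ s ≤ S.comap (π g).toLinearEquiv.toLinearMap := by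
      rw [Submodule.span_le]
      rintro _ ⟨⟨k, F, n⟩, rfl⟩
      exact hsS ⟨(g * k, F, n), by simp⟩
    exact Submodule.topologicalClosure_minimal _ hspan
      ((Submodule.isClosed_topologicalClosure _).preimage (π g).continuous)
  have : CompleteSpace S :=
    (Submodule.isClosed_topologicalClosure (Submodule.span ℂ s)).completeSpace_coe
  have : TopologicalSpace.SeparableSpace S := by
    have hsep : TopologicalSpace.IsSeparable (S : Set E) :=
      (Set.countable_range _).isSeparable.span.closure
    exact hsep.separableSpace
  obtain ⟨v, hv, hinv⟩ := hT.exists_invariant_of_separableSpace (unitarySubrep π S hS)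
    (fun F ε hε => by
      obtain ⟨n, hn⟩ := exists_nat_one_div_lt hε
      refine ⟨⟨u F n, hsS ⟨(1, F, n), by simp⟩⟩, hu_norm F n, fun g hg => ?_⟩
      exact (hu F n g hg).trans hn)
  exact ⟨v, by simpa using hv, fun g => congrArg Subtype.val (hinv g)⟩

/-- Under property (T), an asymptotically invariant sequence of vectors is asymptotic to a
sequence of invariant vectors. -/
lemma HasPropertyT.exists_invariant_tendsto {G E : Type*} [Group G] [Countable G]
    [NormedAddCommGroup E] [InnerProductSpace ℂ E] [CompleteSpace E]
    (hT : HasPropertyT G) (π : G →* (E ≃ₗᵢ[ℂ] E)) (ξ : ℕ → E)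
    (hξ : ∀ g, Tendsto (fun n => ‖π g (ξ n) - ξ n‖) atTop (𝓝 0)) :
    ∃ f : ℕ → E, (∀ n g, π g (f n) = f n) ∧ Tendsto (fun n => ‖ξ n - f n‖) atTop (𝓝 0) := by
  let W : Submodule ℂ E := ⨅ g, LinearMap.eqLocus (π g).toLinearEquiv.toLinearMap LinearMap.id
  have hW : ∀ v, v ∈ W ↔ ∀ g, π g v = v := fun v => by simp [W, Submodule.mem_iInf]
  have hWclosed : IsClosed (W : Set E) := by
    have : (W : Set E) = ⋂ g, {v | π g v = v} := by ext v; simp [hW]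
    rw [this]
    exact isClosed_iInter fun g => isClosed_eq (π g).continuous continuous_id
  have : CompleteSpace W := hWclosed.completeSpace_coe
  have hperp : ∀ g, ∀ v ∈ Wᗮ, π g v ∈ Wᗮ := by
    intro g v hv w hw
    rw [← (hW w).1 hw g, LinearIsometryEquiv.inner_map_map]
    exact hv w hw
  have hfix : ∀ n g, π g (W.starProjection (ξ n)) = W.starProjection (ξ n) := fun n =>
    (hW _).1 (W.starProjection_apply_mem _)
  refine ⟨fun n => W.starProjection (ξ n), hfix, ?_⟩
  by_contra hcon
  obtain ⟨δ, hδ, hfreq⟩ : ∃ δ > 0, ∃ᶠ n in atTop, δ ≤ ‖ξ n - W.starProjection (ξ n)‖ := by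
    simp only [Metric.tendsto_nhds, dist_zero_right, norm_norm] at hcon
    push Not at hcon
    simpa using hcon
  obtain ⟨v, hv, hinv⟩ := hT.exists_invariant (unitarySubrep π Wᗮ hperp) (by
    intro F ε hε
    have hev : ∀ᶠ n in atTop, ∀ g ∈ F, ‖π g (ξ n) - ξ n‖ < ε * δ :=
      (Filter.eventually_all_finset F).2 fun g _ => (hξ g).eventually_lt_const (by positivity)
    obtain ⟨n, hn, hnF⟩ := (hfreq.and_eventually hev).exists
    set η : Wᗮ := ⟨ξ n - W.starProjection (ξ n), W.sub_starProjection_mem_orthogonal _⟩ with hη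
    have hηpos : 0 < ‖η‖ := hδ.trans_le hn
    refine ⟨((‖η‖⁻¹ : ℝ) : ℂ) • η, ?_, fun g hg => ?_⟩
    · rw [norm_smul, Complex.norm_real, norm_inv, norm_norm, inv_mul_cancel₀ hηpos.ne']
    · have hdiff : ‖unitarySubrep π Wᗮ hperp g η - η‖ = ‖π g (ξ n) - ξ n‖ := by
        rw [Submodule.coe_norm]
        congr 1
        simp [hη, hfix]
      rw [map_smul, ← smul_sub, norm_smul, Complex.norm_real, norm_inv, norm_norm, hdiff,
        inv_mul_lt_iff₀ hηpos, mul_comm]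
      exact (hnF g hg).trans_le (by gcongr; exact hn))
  refine hv (Subtype.ext ?_)
  have hvW : (v : E) ∈ W := (hW _).2 fun g => congrArg Subtype.val (hinv g)
  exact inner_self_eq_zero.1 (v.2 v hvW)

end UnitaryRepresentations

section EquivariantSets

/-- A sequence of measurable equivariant random subsets of `H`, almost surely one of which is
finite and nonempty, witnesses essential triviality. -/
lemma essTrivialCocycle_of_equivariant_sets {Γ H X : Type*} [Group H] [Countable H]
    [MeasurableSpace X] {μ : Measure X} {σ : Γ → X → X} {c : Γ → X → H}
    (S : ℕ → X → Set H) (hS_meas : ∀ j h, MeasurableSet {x | h ∈ S j x})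
    (hS_equiv : ∀ g, ∀ᵐ x ∂μ, ∀ j h, c g x * h ∈ S j (σ g x) ↔ h ∈ S j x)
    (hS : ∀ᵐ x ∂μ, ∃ j, (S j x).Nonempty ∧ (S j x).Finite) :
    EssTrivialCocycle μ σ c := by
  classical
  let good (j : ℕ) (x : X) : Prop := ∃ F : Finset H, F.Nonempty ∧ S j x = F
  have hlevel : ∀ j (F : Finset H), MeasurableSet {x | S j x = F} := by
    intro j F
    simp only [Set.ext_iff, Set.ofPred_forall]
    exact MeasurableSet.iInter fun h => (hS_meas j h).iff (MeasurableSet.const _)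
  have hgood : ∀ j, MeasurableSet {x | good j x} := by
    intro j
    simp only [good, Set.ofPred_exists]
    exact MeasurableSet.iUnion fun F => (MeasurableSet.const _).inter (hlevel j F)
  have hnone : MeasurableSet {x | ∀ j, ¬ good j x} := by
    simp only [Set.ofPred_forall]
    exact MeasurableSet.iInter fun j => (hgood j).compl
  have hfirst : ∀ j, MeasurableSet {x | ∀ i < j, ¬ good i x} := by
    intro j
    simp only [Set.ofPred_forall]
    exact MeasurableSet.iInter fun i => MeasurableSet.iInter fun _ => (hgood i).compl
  let φ : X → Finset H := fun x =>
    if h : ∃ j, good j x then (Nat.find_spec h).choose else {1}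
  have hφ_good : ∀ x (h : ∃ j, good j x), (φ x).Nonempty ∧ S (Nat.find h) x = φ x := by
    intro x h
    simp only [φ, dif_pos h]
    exact (Nat.find_spec h).choose_spec
  have hφ_bad : ∀ x, (¬ ∃ j, good j x) → φ x = {1} := fun x h => by simp only [φ, dif_neg h]
  refine ⟨φ, fun F => ?_, fun x => ?_, fun g => ?_⟩
  · have key : {x | φ x = F} =
        {x | ∃ j, (good j x ∧ ∀ i < j, ¬ good i x) ∧ S j x = F} ∪
        {x | (∀ j, ¬ good j x) ∧ ({1} : Finset H) = F} := by
      ext x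
      simp only [Set.mem_ofPred_eq, Set.mem_union]
      by_cases h : ∃ j, good j x
      · have hfind : ∀ j, (good j x ∧ ∀ i < j, ¬ good i x) ↔ Nat.find h = j := fun j =>
          (Nat.find_eq_iff h).symm
        have hnot : ¬ ∀ j, ¬ good j x := by simpa using h
        simp [hfind, hnot, (hφ_good x h).2]
      · have hall : ∀ j, ¬ good j x := by simpa using h
        simp [hall, hφ_bad x h]
    rw [key]
    refine MeasurableSet.union ?_ ?_
    · simp only [Set.ofPred_exists]
      exact MeasurableSet.iUnion fun j => ((hgood j).inter (hfirst j)).inter (hlevel j F)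
    · exact hnone.inter (MeasurableSet.const _)
  · by_cases h : ∃ j, good j x
    · exact (hφ_good x h).1
    · simp [hφ_bad x h]
  · filter_upwards [hS_equiv g, hS] with x hx hex
    have himage : ∀ j, S j (σ g x) = (fun h => c g x * h) '' S j x := by
      intro j
      ext k
      rw [Set.image_mul_left, Set.mem_preimage, ← hx, mul_inv_cancel_left]
    have hgood_iff : ∀ j y, good j y ↔ (S j y).Nonempty ∧ (S j y).Finite := by
      intro j y
      constructor
      · rintro ⟨F, hF, h⟩
        rw [h]
        exact ⟨by simpa using hF, F.finite_toSet⟩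
      · rintro ⟨hne, hfin⟩
        exact ⟨hfin.toFinset, by simpa using hne, by simp⟩
    have hgood_smul : ∀ j, good j (σ g x) ↔ good j x := by
      intro j
      rw [hgood_iff, hgood_iff, himage, Set.image_nonempty,
        Set.finite_image_iff (mul_right_injective _).injOn]
    have h : ∃ j, good j x := hex.imp fun j hj => (hgood_iff j x).2 hj
    have h' : ∃ j, good j (σ g x) := h.imp fun j hj => (hgood_smul j).2 hj
    have hfind : Nat.find h' = Nat.find h := Nat.find_congr' (hgood_smul _)
    rw [← (hφ_good _ h').2, ← (hφ_good x h).2, hfind, himage]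

end EquivariantSets

section SkewProduct

/-- The skew product action on `X × H` associated with a cocycle. -/
def skewMap {G H X : Type*} [Group H] [SMul G X] (c : G → X → H) (g : G) (p : X × H) : X × H :=
  (g • p.1, c g p.1 * p.2)

variable {G H X : Type*} [Group G] [Group H] [MeasurableSpace H] [MeasurableSpace X]
  {μ : Measure X} [MulAction G X] {c : G → X → H}

lemma measurePreserving_skewMap [Countable H] [MeasurableSingletonClass H]
    [SFinite μ] [SMulInvariantMeasure G X μ]
    (hsmul_meas : ∀ g : G, Measurable fun x : X => g • x)
    (hc_meas : ∀ g : G, Measurable (c g)) (g : G) :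
    MeasurePreserving (skewMap c g) (μ.prod Measure.count) (μ.prod Measure.count) := by
  have hg : MeasurePreserving (fun x : X => g • x) μ μ := by
    refine ⟨hsmul_meas g, Measure.ext fun s hs => ?_⟩
    rw [Measure.map_apply (hsmul_meas g) hs]
    exact SMulInvariantMeasure.measure_preimage_smul g hs
  refine hg.skew_product (g := fun x h => c g x * h) ?_ (ae_of_all _ fun x => ?_)
  · exact ((hc_meas g).comp measurable_fst).mul measurable_snd
  · exact map_mul_left_eq_self _ _

lemma skewMap_mul_ae
    (hc_cocycle : ∀ g₁ g₂ : G, ∀ᵐ x ∂μ, c (g₁ * g₂) x = c g₁ (g₂ • x) * c g₂ x) (g₁ g₂ : G) :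
    skewMap c (g₁ * g₂) =ᵐ[μ.prod Measure.count] skewMap c g₁ ∘ skewMap c g₂ := by
  filter_upwards [Measure.quasiMeasurePreserving_fst.ae (hc_cocycle g₁ g₂)] with p hp
  simp [skewMap, hp, mul_smul, mul_assoc]

lemma skewMap_one_ae
    (hc_cocycle : ∀ g₁ g₂ : G, ∀ᵐ x ∂μ, c (g₁ * g₂) x = c g₁ (g₂ • x) * c g₂ x) :
    skewMap c (1 : G) =ᵐ[μ.prod Measure.count] id := by
  filter_upwards [Measure.quasiMeasurePreserving_fst.ae (hc_cocycle 1 1)] with p hp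
  have : c 1 p.1 = 1 := by simpa using hp
  simp [skewMap, this]

/-- The Koopman representation of the skew product action on `L²(X × H)`. -/
noncomputable def skewKoopman [Countable H] [MeasurableSingletonClass H]
    [SFinite μ] [SMulInvariantMeasure G X μ]
    (hsmul_meas : ∀ g : G, Measurable fun x : X => g • x)
    (hc_meas : ∀ g : G, Measurable (c g))
    (hc_cocycle : ∀ g₁ g₂ : G, ∀ᵐ x ∂μ, c (g₁ * g₂) x = c g₁ (g₂ • x) * c g₂ x) :
    G →* (Lp ℂ 2 (μ.prod (Measure.count : Measure H)) ≃ₗᵢ[ℂ]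
      Lp ℂ 2 (μ.prod (Measure.count : Measure H))) :=
  have hmp := measurePreserving_skewMap (μ := μ) hsmul_meas hc_meas
  unitaryRepOfIsometries
    (fun g => Lp.compMeasurePreservingₗᵢ ℂ (skewMap c g⁻¹) (hmp g⁻¹))
    (fun v => by
      refine Lp.ext ((Lp.coeFn_compMeasurePreserving v (hmp 1⁻¹)).trans ?_)
      rw [inv_one]
      filter_upwards [skewMap_one_ae hc_cocycle] with p hp
      simp [hp])
    (fun g h v => by
      refine Lp.ext ((Lp.coeFn_compMeasurePreserving v (hmp (g * h)⁻¹)).trans ?_)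
      refine EventuallyEq.trans ?_ (Lp.coeFn_compMeasurePreserving
        (Lp.compMeasurePreservingₗᵢ ℂ (skewMap c h⁻¹) (hmp h⁻¹) v) (hmp g⁻¹)).symm
      rw [mul_inv_rev]
      filter_upwards [skewMap_mul_ae hc_cocycle h⁻¹ g⁻¹, (hmp g⁻¹).quasiMeasurePreserving.ae
        (Lp.coeFn_compMeasurePreserving v (hmp h⁻¹))] with p hp hp'
      simp only [Function.comp_apply, hp] at hp' ⊢
      exact hp'.symm)

lemma skewKoopman_apply_ae [Countable H] [MeasurableSingletonClass H]
    [SFinite μ] [SMulInvariantMeasure G X μ]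
    (hsmul_meas : ∀ g : G, Measurable fun x : X => g • x)
    (hc_meas : ∀ g : G, Measurable (c g))
    (hc_cocycle : ∀ g₁ g₂ : G, ∀ᵐ x ∂μ, c (g₁ * g₂) x = c g₁ (g₂ • x) * c g₂ x) (g : G)
    (f : Lp ℂ 2 (μ.prod (Measure.count : Measure H))) :
    skewKoopman hsmul_meas hc_meas hc_cocycle g f =ᵐ[μ.prod Measure.count]
      f ∘ skewMap c g⁻¹ :=
  Lp.coeFn_compMeasurePreserving f (measurePreserving_skewMap hsmul_meas hc_meas g⁻¹)

end SkewProduct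

section SquareIntegrable

variable {H X : Type*} [MeasurableSpace H] [MeasurableSpace X] {μ : Measure X}

lemma ae_forall_of_ae_prod_count [Countable H] {p : X × H → Prop}
    (hp : ∀ᵐ z ∂μ.prod Measure.count, p z) : ∀ᵐ x ∂μ, ∀ h, p (x, h) := by
  filter_upwards [Measure.ae_ae_of_ae_prod hp] with x hx
  simpa using hx

lemma eLpNorm_two_sq_prod_count [Countable H] [MeasurableSingletonClass H] {f : X × H → ℂ}
    (hf : AEStronglyMeasurable f (μ.prod Measure.count)) :
    eLpNorm f 2 (μ.prod Measure.count) ^ 2 = ∫⁻ x, ∑' h, ‖f (x, h)‖ₑ ^ 2 ∂μ := by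
  have h := eLpNorm_nnreal_pow_eq_lintegral (f := f) (μ := μ.prod (Measure.count : Measure H))
    (p := 2) two_ne_zero
  simp only [NNReal.coe_ofNat, ENNReal.rpow_ofNat, ENNReal.coe_ofNat] at h
  rw [h, lintegral_prod _ (hf.enorm.pow_const 2)]
  simp_rw [lintegral_count]

end SquareIntegrable

section KoopmanNorm

variable {G H X : Type*} [Group G] [Group H] [Countable H] [MeasurableSpace H]
  [MeasurableSingletonClass H] [MeasurableSpace X] {μ : Measure X} [SFinite μ]
  [MulAction G X] [SMulInvariantMeasure G X μ] {c : G → X → H}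

lemma enorm_skewKoopman_sub_sq (hsmul_meas : ∀ g : G, Measurable fun x : X => g • x)
    (hc_meas : ∀ g : G, Measurable (c g))
    (hc_cocycle : ∀ g₁ g₂ : G, ∀ᵐ x ∂μ, c (g₁ * g₂) x = c g₁ (g₂ • x) * c g₂ x) (g : G)
    {v : Lp ℂ 2 (μ.prod (Measure.count : Measure H))} {ξ : X × H → ℂ}
    (hv : v =ᵐ[μ.prod Measure.count] ξ) (hξ : Measurable ξ) :
    ‖skewKoopman hsmul_meas hc_meas hc_cocycle g v - v‖ₑ ^ 2 =
      ∫⁻ x, ∑' h, ‖ξ (skewMap c g⁻¹ (x, h)) - ξ (x, h)‖ₑ ^ 2 ∂μ := by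
  have hmp := measurePreserving_skewMap (μ := μ) hsmul_meas hc_meas g⁻¹
  rw [Lp.enorm_def, ← eLpNorm_two_sq_prod_count (f := fun z => ξ (skewMap c g⁻¹ z) - ξ z)
    ((hξ.comp hmp.measurable).sub hξ).aestronglyMeasurable]
  congr 1
  refine eLpNorm_congr_ae ?_
  filter_upwards [Lp.coeFn_sub (skewKoopman hsmul_meas hc_meas hc_cocycle g v) v,
    skewKoopman_apply_ae hsmul_meas hc_meas hc_cocycle g v, hv,
    hmp.quasiMeasurePreserving.ae hv] with z h₁ h₂ h₃ h₄
  rw [h₁, Pi.sub_apply, h₂, Function.comp_apply, h₃, h₄]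

end KoopmanNorm

section ProbabilityVectors

variable {H : Type*} {p q : H → ℝ}

lemma IsProbVec.summable (hp : IsProbVec p) : Summable p := by
  by_contra h
  simpa [tsum_eq_zero_of_not_summable h] using hp.2

lemma IsProbVec.tsum_ofReal (hp : IsProbVec p) : ∑' h, ENNReal.ofReal (p h) = 1 := by
  rw [← ENNReal.ofReal_tsum_of_nonneg hp.1 hp.summable, hp.2, ENNReal.ofReal_one]

lemma IsProbVec.lshift [Group H] (hp : IsProbVec p) (a : H) : IsProbVec (lshift a p) :=
  ⟨fun _ => hp.1 _, ((Equiv.mulLeft a⁻¹).tsum_eq p).trans hp.2⟩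

lemma IsProbVec.ofReal_l1dist (hp : IsProbVec p) (hq : IsProbVec q) :
    ENNReal.ofReal (l1dist p q) = ∑' h, ENNReal.ofReal |p h - q h| :=
  ENNReal.ofReal_tsum_of_nonneg (fun _ => abs_nonneg _) (hp.summable.sub hq.summable).abs

lemma IsProbVec.l1dist_le_two (hp : IsProbVec p) (hq : IsProbVec q) : l1dist p q ≤ 2 := by
  calc l1dist p q ≤ ∑' h, (p h + q h) :=
        (hp.summable.sub hq.summable).abs.tsum_le_tsum
          (fun h => abs_le.2 ⟨by linarith [hp.1 h], by linarith [hq.1 h]⟩)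
          (hp.summable.add hq.summable)
    _ = 2 := by rw [hp.summable.tsum_add hq.summable, hp.2, hq.2]; norm_num

lemma enorm_ofReal_sqrt_sq {a : ℝ} (ha : 0 ≤ a) : ‖((√a : ℝ) : ℂ)‖ₑ ^ 2 = ENNReal.ofReal a := by
  rw [← ofReal_norm, ← ENNReal.ofReal_pow (norm_nonneg _), Complex.norm_real,
    Real.norm_eq_abs, sq_abs, Real.sq_sqrt ha]

lemma enorm_ofReal_sqrt_sub_sq_le {a b : ℝ} (ha : 0 ≤ a) (hb : 0 ≤ b) :
    ‖((√a : ℝ) : ℂ) - ((√b : ℝ) : ℂ)‖ₑ ^ 2 ≤ ENNReal.ofReal |a - b| := by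
  rw [← ofReal_norm, ← ENNReal.ofReal_pow (norm_nonneg _), ← Complex.ofReal_sub,
    Complex.norm_real, Real.norm_eq_abs]
  refine ENNReal.ofReal_le_ofReal ?_
  have hfac : |a - b| = |√a - √b| * (√a + √b) := by
    rw [← abs_of_nonneg (add_nonneg (Real.sqrt_nonneg a) (Real.sqrt_nonneg b)), ← abs_mul]
    congr 1
    nlinarith [Real.sq_sqrt ha, Real.sq_sqrt hb]
  rw [hfac, sq]
  refine mul_le_mul_of_nonneg_left (abs_le.2 ⟨?_, ?_⟩) (abs_nonneg _) <;>
    linarith [Real.sqrt_nonneg a, Real.sqrt_nonneg b]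

/-- The square-root map sends the translated `ℓ¹` distance to an upper bound for the squared
translated `ℓ²` distance. -/
lemma IsProbVec.tsum_enorm_sqrt_sub_sq_le [Group H] (hp : IsProbVec p) (hq : IsProbVec q)
    (a : H) : ∑' h, ‖((√(p (a * h)) : ℝ) : ℂ) - ((√(q h) : ℝ) : ℂ)‖ₑ ^ 2 ≤
      ENNReal.ofReal (l1dist p (_root_.lshift a q)) := by
  rw [hp.ofReal_l1dist (hq.lshift a), 
    ← (Equiv.mulLeft a).tsum_eq fun h => ENNReal.ofReal |p h - _root_.lshift a q h|]
  refine ENNReal.tsum_le_tsum fun h => ?_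
  simpa [_root_.lshift] using enorm_ofReal_sqrt_sub_sq_le (hp.1 (a * h)) (hq.1 h)

end ProbabilityVectors

lemma tendsto_norm_zero_iff_enorm_sq {E : Type*} [NormedAddCommGroup E] {u : ℕ → E} :
    Tendsto (fun n => ‖u n‖) atTop (𝓝 0) ↔ Tendsto (fun n => ‖u n‖ₑ ^ 2) atTop (𝓝 0) := by
  have hu : ∀ n, ‖u n‖ₑ ^ 2 = ENNReal.ofReal (‖u n‖ ^ 2) := fun n => by
    rw [← ofReal_norm, ENNReal.ofReal_pow (norm_nonneg _)]
  constructor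
  · intro h
    simp_rw [hu]
    simpa using ENNReal.tendsto_ofReal (h.pow 2)
  · intro h
    have h' := ((ENNReal.tendsto_toReal ENNReal.zero_ne_top).comp h).sqrt
    simpa [Function.comp_def, Real.sqrt_sq] using h'

section RandomProbabilityVectors

variable {G H X : Type*} [Group G] [Countable H] [MeasurableSpace H]
  [MeasurableSingletonClass H] [MeasurableSpace X] {μ : Measure X} [IsProbabilityMeasure μ]

lemma measurable_sqrt_prod {φ : X → H → ℝ} (hφ : ∀ h, Measurable fun x => φ x h) :
    Measurable fun z : X × H => ((√(φ z.1 z.2) : ℝ) : ℂ) :=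
  measurable_from_prod_countable_left fun h => Complex.measurable_ofReal.comp (hφ h).sqrt

lemma memLp_sqrt_of_isProbVec {φ : X → H → ℝ} (hφ : ∀ h, Measurable fun x => φ x h)
    (hprob : ∀ x, IsProbVec (φ x)) :
    MemLp (fun z : X × H => ((√(φ z.1 z.2) : ℝ) : ℂ)) 2 (μ.prod Measure.count) := by
  have hmeas := (measurable_sqrt_prod hφ).aestronglyMeasurable (μ := μ.prod Measure.count)
  refine ⟨hmeas, ?_⟩
  have h := eLpNorm_two_sq_prod_count hmeas
  simp only [enorm_ofReal_sqrt_sq ((hprob _).1 _), (hprob _).tsum_ofReal, lintegral_one,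
    measure_univ] at h
  refine lt_top_iff_ne_top.2 fun htop => ?_
  simp [htop] at h

/-- The square root of a random probability vector, as a vector of `L²(X × H)`. -/
noncomputable def sqrtLp (μ : Measure X) [IsProbabilityMeasure μ] {φ : X → H → ℝ}
    (hφ : ∀ h, Measurable fun x => φ x h) (hprob : ∀ x, IsProbVec (φ x)) :
    Lp ℂ 2 (μ.prod (Measure.count : Measure H)) :=
  (memLp_sqrt_of_isProbVec hφ hprob).toLp _

lemma coeFn_sqrtLp {φ : X → H → ℝ} (hφ : ∀ h, Measurable fun x => φ x h)
    (hprob : ∀ x, IsProbVec (φ x)) :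
    sqrtLp μ hφ hprob =ᵐ[μ.prod Measure.count] fun z => ((√(φ z.1 z.2) : ℝ) : ℂ) :=
  (memLp_sqrt_of_isProbVec hφ hprob).coeFn_toLp

lemma tendsto_skewKoopman_sub [Group H] [MulAction G X] [SMulInvariantMeasure G X μ]
    {c : G → X → H} (hsmul_meas : ∀ g : G, Measurable fun x : X => g • x)
    (hc_meas : ∀ g : G, Measurable (c g))
    (hc_cocycle : ∀ g₁ g₂ : G, ∀ᵐ x ∂μ, c (g₁ * g₂) x = c g₁ (g₂ • x) * c g₂ x)
    {φ : ℕ → X → H → ℝ} (hφ : ∀ n h, Measurable fun x => φ n x h)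
    (hprob : ∀ n x, IsProbVec (φ n x)) (g : G)
    (hlim : ∀ᵐ x ∂μ, Tendsto
      (fun n => l1dist (φ n (g⁻¹ • x)) (lshift (c g⁻¹ x) (φ n x))) atTop (𝓝 0)) :
    Tendsto (fun n => ‖skewKoopman hsmul_meas hc_meas hc_cocycle g (sqrtLp μ (hφ n) (hprob n)) -
      sqrtLp μ (hφ n) (hprob n)‖) atTop (𝓝 0) := by
  have hmp := measurePreserving_skewMap (μ := μ) hsmul_meas hc_meas g⁻¹
  let ξ : ℕ → X × H → ℂ := fun n z => ((√(φ n z.1 z.2) : ℝ) : ℂ)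
  have hξ : ∀ n, Measurable (ξ n) := fun n => measurable_sqrt_prod (hφ n)
  have hdiff : ∀ n, Measurable fun z => ξ n (skewMap c g⁻¹ z) - ξ n z := fun n =>
    ((hξ n).comp hmp.measurable).sub (hξ n)
  have hbound : ∀ n x, ∑' h, ‖ξ n (skewMap c g⁻¹ (x, h)) - ξ n (x, h)‖ₑ ^ 2 ≤
      ENNReal.ofReal (l1dist (φ n (g⁻¹ • x)) (lshift (c g⁻¹ x) (φ n x))) := fun n x =>
    (hprob n (g⁻¹ • x)).tsum_enorm_sqrt_sub_sq_le (hprob n x) (c g⁻¹ x)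
  have hnorm := fun n => enorm_skewKoopman_sub_sq hsmul_meas hc_meas hc_cocycle g
    (coeFn_sqrtLp (μ := μ) (hφ n) (hprob n)) (hξ n)
  have hint : Tendsto
      (fun n => ∫⁻ x, ∑' h, ‖ξ n (skewMap c g⁻¹ (x, h)) - ξ n (x, h)‖ₑ ^ 2 ∂μ) atTop
      (𝓝 (∫⁻ _, 0 ∂μ)) := by
    refine tendsto_lintegral_of_dominated_convergence (fun _ => 2) (fun n => ?_)
      (fun n => ae_of_all _ fun x => ?_) (by simp) ?_
    · exact Measurable.tsum fun h =>
        (((hdiff n).comp measurable_prodMk_right).enorm).pow_const 2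
    · refine (hbound n x).trans ?_
      simpa using ENNReal.ofReal_le_ofReal ((hprob n _).l1dist_le_two ((hprob n x).lshift _))
    · filter_upwards [hlim] with x hx
      refine tendsto_of_tendsto_of_tendsto_of_le_of_le tendsto_const_nhds ?_
        (fun n => zero_le) (fun n => hbound n x)
      simpa using ENNReal.tendsto_ofReal hx
  rw [lintegral_zero] at hint
  rw [tendsto_norm_zero_iff_enorm_sq]
  exact hint.congr fun n => (hnorm n).symm

/-- `L²` functions asymptotic to square roots of random probability vectors cannot all vanish on
a common set of fibres of positive measure. -/
lemma ae_exists_ne_zero_of_tendsto_sqrt {φ : ℕ → X → H → ℝ}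
    (hφ : ∀ n h, Measurable fun x => φ n x h) (hprob : ∀ n x, IsProbVec (φ n x))
    (f : ℕ → Lp ℂ 2 (μ.prod (Measure.count : Measure H)))
    (hf : Tendsto (fun n => ‖sqrtLp μ (hφ n) (hprob n) - f n‖) atTop (𝓝 0)) :
    ∀ᵐ x ∂μ, ∃ n h, f n (x, h) ≠ 0 := by
  have hfm : ∀ n h, Measurable fun x => f n (x, h) := fun n h =>
    (Lp.stronglyMeasurable (f n)).measurable.comp measurable_prodMk_right
  let Z : Set X := {x | ∀ n h, f n (x, h) = 0}
  have hZ : MeasurableSet Z := by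
    simp only [Z, Set.ofPred_forall]
    exact MeasurableSet.iInter fun n => MeasurableSet.iInter fun h =>
      hfm n h (measurableSet_singleton 0)
  have hle : ∀ n,
      μ Z ≤ ‖sqrtLp μ (hφ n) (hprob n) - f n‖ₑ ^ 2 := by
    intro n
    rw [Lp.enorm_def, eLpNorm_two_sq_prod_count (Lp.aestronglyMeasurable _),
      ← lintegral_indicator_one hZ]
    refine lintegral_mono_ae ?_
    filter_upwards [ae_forall_of_ae_prod_count (Lp.coeFn_sub
        (sqrtLp μ (hφ n) (hprob n)) (f n)),
      ae_forall_of_ae_prod_count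
        (coeFn_sqrtLp (μ := μ) (hφ n) (hprob n))] with x h₁ h₂
    by_cases hx : x ∈ Z
    · have h₃ : ∀ h, (sqrtLp μ (hφ n) (hprob n) - f n) (x, h) = ((√(φ n x h) : ℝ) : ℂ) :=
        fun h => by rw [h₁, Pi.sub_apply, h₂, show f n (x, h) = 0 from hx n h, sub_zero]
      simp_rw [h₃, enorm_ofReal_sqrt_sq ((hprob n x).1 _), (hprob n x).tsum_ofReal]
      simp [hx]
    · simp [hx]
  have hnull : μ Z = 0 :=
    le_antisymm (ge_of_tendsto' (tendsto_norm_zero_iff_enorm_sq.1 hf) hle) zero_le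
  filter_upwards [measure_eq_zero_iff_ae_notMem.1 hnull] with x hx
  by_contra! hcon
  exact hx hcon

end RandomProbabilityVectors

lemma ae_finite_setOf_le_enorm_sq {H X : Type*} [Countable H] [MeasurableSpace H]
    [MeasurableSingletonClass H] [MeasurableSpace X] {μ : Measure X}
    (f : Lp ℂ 2 (μ.prod (Measure.count : Measure H))) :
    ∀ᵐ x ∂μ, ∀ ε : ENNReal, ε ≠ 0 → {h | ε ≤ ‖f (x, h)‖ₑ ^ 2}.Finite := by
  have hmeas : Measurable fun x => ∑' h, ‖f (x, h)‖ₑ ^ 2 := Measurable.tsum fun h =>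
    ((Lp.stronglyMeasurable f).measurable.comp measurable_prodMk_right).enorm.pow_const 2
  have hne : ∫⁻ x, ∑' h, ‖f (x, h)‖ₑ ^ 2 ∂μ ≠ ⊤ := by
    rw [← eLpNorm_two_sq_prod_count (Lp.aestronglyMeasurable f)]
    exact ENNReal.pow_ne_top (Lp.eLpNorm_ne_top f)
  filter_upwards [ae_lt_top hmeas hne] with x hx ε hε
  exact ENNReal.finite_const_le_of_tsum_ne_top hx.ne hε

/-- Proposition `ess_triv_amenable` (3). If `G` has property (T), then every
amenable cocycle `c : G × X → H` for a pmp action `G ↷ (X,μ)` is essentially trivial. -/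
theorem amenableCocycle_essTrivial_of_propertyT
    {G H X : Type*} [Group G] [Countable G] [Group H] [Countable H]
    [MeasurableSpace H] [MeasurableSingletonClass H]
    [MeasurableSpace X] (μ : Measure X) [IsProbabilityMeasure μ]
    [MulAction G X] (hsmul_meas : ∀ g : G, Measurable fun x : X => g • x)
    [SMulInvariantMeasure G X μ]
    (hT : HasPropertyT G)
    (c : G → X → H) (hc_meas : ∀ g : G, Measurable (c g))
    (hc_cocycle : ∀ g₁ g₂ : G, ∀ᵐ x ∂μ, c (g₁ * g₂) x = c g₁ (g₂ • x) * c g₂ x)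
    (hc_amen : AmenableCocycle μ (fun (g : G) (x : X) => g • x) c) :
    EssTrivialCocycle μ (fun (g : G) (x : X) => g • x) c := by
  obtain ⟨φ, hφ, hprob, hlim⟩ := hc_amen
  obtain ⟨f, hf_inv, hf⟩ := hT.exists_invariant_tendsto
    (skewKoopman (μ := μ) hsmul_meas hc_meas hc_cocycle) _
    (fun g => tendsto_skewKoopman_sub hsmul_meas hc_meas hc_cocycle hφ hprob g (hlim g⁻¹))
  refine essTrivialCocycle_of_equivariant_sets
    (fun j x => {h | ((j.unpair.2 : ℕ) : ENNReal)⁻¹ ≤ ‖f j.unpair.1 (x, h)‖ₑ ^ 2})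
    (fun j h => ?_) (fun g => ?_) ?_
  · exact measurableSet_le measurable_const (((Lp.stronglyMeasurable _).measurable.comp
      measurable_prodMk_right).enorm.pow_const 2)
  · have hg : ∀ n, ∀ᵐ x ∂μ, ∀ h, f n (g • x, c g x * h) = f n (x, h) := by
      intro n
      refine ae_forall_of_ae_prod_count (p := fun z => f n (skewMap c g z) = f n z) ?_
      have h := skewKoopman_apply_ae hsmul_meas hc_meas hc_cocycle g⁻¹ (f n)
      rw [hf_inv, inv_inv] at h
      exact h.symm
    filter_upwards [ae_all_iff.2 hg] with x hx j h
    simp [hx]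
  · filter_upwards [ae_exists_ne_zero_of_tendsto_sqrt hφ hprob f hf,
      ae_all_iff.2 fun n => ae_finite_setOf_le_enorm_sq (f n)] with x ⟨n, h, hne⟩ hfin
    obtain ⟨m, hm⟩ := ENNReal.exists_inv_nat_lt (a := ‖f n (x, h)‖ₑ ^ 2) (by simpa using hne)
    refine ⟨Nat.pair n m, ⟨h, ?_⟩, hfin _ _ (by simp)⟩
    simpa using hm.le
end

section
/- Let G and H be countable groups with normal subgroups M ⊴ G and N ⊴ H, let Ḡ = G/M and H̄ = H/N, and let (Ω, m) be an ergodic ME-coupling of G and H admitting finite-measure fundamental domains Y, X for G, H respectively with NY ⊆ MY and MX ⊆ NX. Let 𝒜 be the σ-algebra of (M × N)-invariant measurable subsets of Ω. Then there exists a (Ḡ × H̄)-invariant σ-finite measure ν on 𝒜 equivalent to m|_𝒜, unique up to a positive scalar, and the action of Ḡ × H̄ on (𝒜, ν) is an ergodic ME-coupling of Ḡ and H̄; in particular G/M and H/N are measure equivalent. -/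
open MeasureTheory Filter Topology

/-- `(Ω, m)` together with commuting measure-preserving actions `σ` of `G` and `τ` of `H`,
each admitting a finite-measure fundamental domain, is a measure equivalence coupling. -/
structure MECoupling (G H : Type*) {Ω : Type*} [Group G] [Group H]
    [MeasurableSpace Ω] (m : MeasureTheory.Measure Ω)
    (σ : G → Ω → Ω) (τ : H → Ω → Ω) : Prop where
  σ_one : σ 1 = id
  σ_mul : ∀ g₁ g₂, σ (g₁ * g₂) = σ g₁ ∘ σ g₂
  τ_one : τ 1 = id
  τ_mul : ∀ h₁ h₂, τ (h₁ * h₂) = τ h₁ ∘ τ h₂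
  comm : ∀ g h, σ g ∘ τ h = τ h ∘ σ g
  σ_mp : ∀ g, MeasureTheory.MeasurePreserving (σ g) m m
  τ_mp : ∀ h, MeasureTheory.MeasurePreserving (τ h) m m
  exists_dom_G : ∃ Y : Set Ω, MeasurableSet Y ∧ m Y < ⊤ ∧ ∀ᵐ ω ∂m, ∃! g : G, σ g ω ∈ Y
  exists_dom_H : ∃ X : Set Ω, MeasurableSet X ∧ m X < ⊤ ∧ ∀ᵐ ω ∂m, ∃! h : H, τ h ω ∈ X

/-- Two countable groups are measure equivalent if they admit an ME coupling. -/
def MeasureEquivalent (G H : Type*) [Group G] [Group H] : Prop :=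
  ∃ (Ω : Type) (_ : MeasurableSpace Ω) (m : MeasureTheory.Measure Ω)
    (σ : G → Ω → Ω) (τ : H → Ω → Ω), MECoupling G H m σ τ

/-- A group is amenable iff it satisfies Reiter's property: there are `ℓ¹` probability
vectors that are asymptotically invariant under left translation. -/
def IsAmenableGroup (G : Type*) [Group G] : Prop :=
  ∃ φ : ℕ → G → ℝ, (∀ n, IsProbVec (φ n)) ∧
    ∀ g : G, Filter.Tendsto (fun n => l1dist (lshift g (φ n)) (φ n)) Filter.atTop (nhds 0)
open scoped symmDiff

/-- Ergodicity of a coupling. -/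
def ErgodicCoupling {G H Ω : Type*} [Group G] [Group H] [MeasurableSpace Ω]
    (m : Measure Ω) (σ : G → Ω → Ω) (τ : H → Ω → Ω) : Prop :=
  ∀ s : Set Ω, MeasurableSet s → (∀ g : G, m ((σ g ⁻¹' s) ∆ s) = 0) →
    (∀ h : H, m ((τ h ⁻¹' s) ∆ s) = 0) → m s = 0 ∨ m sᶜ = 0

/-- The σ-algebra `𝒜` of `(M × N)`-invariant measurable subsets of `Ω`. -/
def invariantSigma {G H Ω : Type*} [Group G] [Group H] [MeasurableSpace Ω]
    (σ : G → Ω → Ω) (τ : H → Ω → Ω) (M : Subgroup G) (N : Subgroup H) :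
    MeasurableSpace Ω where
  MeasurableSet' s := MeasurableSet s ∧ (∀ a : M, σ (a : G) ⁻¹' s = s) ∧
    (∀ b : N, τ (b : H) ⁻¹' s = s)
  measurableSet_empty :=
    ⟨MeasurableSet.empty, fun _ => Set.preimage_empty, fun _ => Set.preimage_empty⟩
  measurableSet_compl := fun s hs =>
    ⟨hs.1.compl, fun a => by rw [Set.preimage_compl, hs.2.1 a],
      fun b => by rw [Set.preimage_compl, hs.2.2 b]⟩
  measurableSet_iUnion := fun f hf =>
    ⟨MeasurableSet.iUnion fun i => (hf i).1,
      fun a => by simp only [Set.preimage_iUnion]; exact Set.iUnion_congr fun i => (hf i).2.1 a,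
      fun b => by simp only [Set.preimage_iUnion]; exact Set.iUnion_congr fun i => (hf i).2.2 b⟩

open scoped Pointwise ENNReal

namespace MeasureTheory

/-- Radon–Nikodym derivatives between two σ-finite measures are invariant under an invertible map
preserving both measures. -/
lemma rnDeriv_comp_ae_eq_of_leftInverse {α : Type*} [MeasurableSpace α] {μ ν : Measure α}
    [SigmaFinite μ] [SigmaFinite ν] (hνμ : ν ≪ μ) {f g : α → α} (hgf : ∀ x, g (f x) = x)
    (hfμ : MeasurePreserving f μ μ) (hgν : MeasurePreserving g ν ν) :
    ν.rnDeriv μ ∘ f =ᵐ[μ] ν.rnDeriv μ := by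
  have hm := Measure.measurable_rnDeriv ν μ
  rw [← withDensity_eq_iff_of_sigmaFinite (hm.comp hfμ.measurable).aemeasurable hm.aemeasurable,
    Measure.withDensity_rnDeriv_eq _ _ hνμ]
  ext s hs
  have hs' : s = f ⁻¹' (g ⁻¹' s) := by ext x; simp [hgf]
  have hgs := hgν.measurable hs
  calc (μ.withDensity (ν.rnDeriv μ ∘ f)) s
      = ∫⁻ x in f ⁻¹' (g ⁻¹' s), ν.rnDeriv μ (f x) ∂μ := by
        rw [withDensity_apply _ hs, ← hs']; rfl
    _ = ∫⁻ x in g ⁻¹' s, ν.rnDeriv μ x ∂μ := hfμ.setLIntegral_comp_preimage hgs hm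
    _ = ν s := by
      rw [Measure.setLIntegral_rnDeriv hνμ, hgν.measure_preimage hs.nullMeasurableSet]

/-- Two equivalent σ-finite measures invariant under a family of invertible maps, one of them
ergodic, are proportional. -/
lemma exists_eq_smul_of_ergodic_family {α ι : Type*} [MeasurableSpace α] {μ ν : Measure α}
    [SigmaFinite μ] [SigmaFinite ν] (hνμ : ν ≪ μ) (hμν : μ ≪ ν) {f g : ι → α → α}
    (hgf : ∀ i x, g i (f i x) = x)
    (hfμ : ∀ i, MeasurePreserving (f i) μ μ) (hgν : ∀ i, MeasurePreserving (g i) ν ν)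
    (herg : ∀ s, MeasurableSet s → (∀ i, μ ((f i ⁻¹' s) ∆ s) = 0) → μ s = 0 ∨ μ sᶜ = 0) :
    ∃ r : ℝ≥0∞, r ≠ 0 ∧ r ≠ ⊤ ∧ ν = r • μ := by
  rcases eq_or_ne μ 0 with rfl | hμ
  · exact ⟨1, one_ne_zero, ENNReal.one_ne_top, by
      rw [Measure.absolutelyContinuous_zero_iff.mp hνμ, smul_zero]⟩
  have hm := Measure.measurable_rnDeriv ν μ
  obtain ⟨r, hr⟩ : ∃ r, ν.rnDeriv μ =ᵐ[μ] Function.const α r := by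
    refine exists_eventuallyEq_const_of_forall_separating MeasurableSet fun U hU => ?_
    refine (herg (ν.rnDeriv μ ⁻¹' U) (hm hU) fun i => ?_).symm.imp (fun h => ?_) (fun h => ?_)
    · rw [measure_symmDiff_eq_zero_iff]
      filter_upwards [rnDeriv_comp_ae_eq_of_leftInverse hνμ (hgf i) (hfμ i) (hgν i)] with x hx
      change (ν.rnDeriv μ (f i x) ∈ U) = (ν.rnDeriv μ x ∈ U)
      rw [← hx]; rfl
    · exact h
    · exact measure_eq_zero_iff_ae_notMem.mp h
  have hν : ν = r • μ := by
    rw [← Measure.withDensity_rnDeriv_eq _ _ hνμ, withDensity_congr_ae hr]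
    exact withDensity_const r
  refine ⟨r, ?_, ?_, hν⟩
  · rintro rfl
    rw [zero_smul] at hν
    exact hμ (Measure.absolutelyContinuous_zero_iff.mp (hν ▸ hμν))
  · rintro rfl
    have : NeZero μ := ⟨hμ⟩
    obtain ⟨x, hx, hx'⟩ := (hr.and (Measure.rnDeriv_lt_top ν μ)).exists
    rw [hx] at hx'
    exact lt_irrefl _ hx'

end MeasureTheory

section Coupling

variable {G H Ω : Type*} [Group G] [Group H] [MeasurableSpace Ω] {m : Measure Ω}
  {σ : G → Ω → Ω} {τ : H → Ω → Ω}

namespace MECoupling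

lemma swap (hME : MECoupling G H m σ τ) : MECoupling H G m τ σ where
  σ_one := hME.τ_one
  σ_mul := hME.τ_mul
  τ_one := hME.σ_one
  τ_mul := hME.σ_mul
  comm h g := (hME.comm g h).symm
  σ_mp := hME.τ_mp
  τ_mp := hME.σ_mp
  exists_dom_G := hME.exists_dom_H
  exists_dom_H := hME.exists_dom_G

lemma τ_τ (hME : MECoupling G H m σ τ) (h h' : H) (ω : Ω) : τ h (τ h' ω) = τ (h * h') ω := by
  rw [hME.τ_mul]; rfl

lemma σ_τ (hME : MECoupling G H m σ τ) (g : G) (h : H) (ω : Ω) :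
    σ g (τ h ω) = τ h (σ g ω) :=
  congrFun (hME.comm g h) ω

lemma τ_inv_τ (hME : MECoupling G H m σ τ) (h : H) (ω : Ω) : τ h⁻¹ (τ h ω) = ω := by
  rw [hME.τ_τ, inv_mul_cancel, hME.τ_one]; rfl

lemma τ_τ_inv (hME : MECoupling G H m σ τ) (h : H) (ω : Ω) : τ h (τ h⁻¹ ω) = ω := by
  rw [hME.τ_τ, mul_inv_cancel, hME.τ_one]; rfl

lemma image_τ (hME : MECoupling G H m σ τ) (h : H) (s : Set Ω) : τ h '' s = τ h⁻¹ ⁻¹' s :=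
  congrFun (Set.image_eq_preimage_of_inverse (hME.τ_inv_τ h) (hME.τ_τ_inv h)) s

/-- The action of `H` underlying a coupling of `G` and `H`. -/
abbrev rightAction (hME : MECoupling G H m σ τ) : MulAction H Ω where
  smul := τ
  one_smul ω := congrFun hME.τ_one ω
  mul_smul h h' ω := (hME.τ_τ h h' ω).symm

end MECoupling

lemma invariantSigma_swap (σ : G → Ω → Ω) (τ : H → Ω → Ω) (M : Subgroup G) (N : Subgroup H) :
    invariantSigma τ σ N M = invariantSigma σ τ M N :=
  MeasurableSpace.ext fun _ => and_congr_right fun _ => and_comm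

variable {M : Subgroup G} {N : Subgroup H}

lemma invariantSigma_le : invariantSigma σ τ M N ≤ ‹MeasurableSpace Ω› := fun _ hs => hs.1

namespace MECoupling

lemma measurableSet_invariantSigma (hME : MECoupling G H m σ τ) {s : Set Ω}
    (hs : MeasurableSet s) (hM : ∀ a ∈ M, ∀ ω ∈ s, σ a ω ∈ s)
    (hN : ∀ b ∈ N, ∀ ω ∈ s, τ b ω ∈ s) : (invariantSigma σ τ M N).MeasurableSet' s := by
  refine ⟨hs, fun a => ?_, fun b => ?_⟩
  · refine Set.Subset.antisymm (fun ω hω => ?_) (hM a a.2)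
    have := hM _ (M.inv_mem a.2) _ hω
    rwa [hME.swap.τ_inv_τ] at this
  · refine Set.Subset.antisymm (fun ω hω => ?_) (hN b b.2)
    have := hN _ (N.inv_mem b.2) _ hω
    rwa [hME.τ_inv_τ] at this

lemma measurableSet_invariantSigma_preimage_τ [N.Normal] (hME : MECoupling G H m σ τ) (h : H)
    {s : Set Ω} (hs : (invariantSigma σ τ M N).MeasurableSet' s) :
    (invariantSigma σ τ M N).MeasurableSet' (τ h ⁻¹' s) := by
  refine hME.measurableSet_invariantSigma ((hME.τ_mp h).measurable hs.1)
    (fun a ha ω hω => ?_) (fun b hb ω hω => ?_)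
  · rw [Set.mem_preimage, ← hME.σ_τ]
    exact (Set.ext_iff.mp (hs.2.1 ⟨a, ha⟩) _).mpr hω
  · have := (Set.ext_iff.mp (hs.2.2 ⟨h * b * h⁻¹, ‹N.Normal›.conj_mem b hb h⟩) _).mpr hω
    simpa [hME.τ_τ] using this

lemma measurableSet_invariantSigma_preimage_σ [M.Normal] (hME : MECoupling G H m σ τ) (g : G)
    {s : Set Ω} (hs : (invariantSigma σ τ M N).MeasurableSet' s) :
    (invariantSigma σ τ M N).MeasurableSet' (σ g ⁻¹' s) := by
  rw [← invariantSigma_swap] at hs ⊢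
  exact hME.swap.measurableSet_invariantSigma_preimage_τ g hs

/-- An `m`-null set is contained in an `m`-null set of the invariant σ-algebra. -/
lemma ae_of_ae [Countable G] [Countable H] (hME : MECoupling G H m σ τ)
    {ν : @Measure Ω (invariantSigma σ τ M N)}
    (hν : ∀ s, (invariantSigma σ τ M N).MeasurableSet' s → m s = 0 → ν s = 0)
    {p : Ω → Prop} (hp : ∀ᵐ ω ∂m, p ω) : ∀ᵐ ω ∂ν, p ω := by
  obtain ⟨t, hpt, ht, ht0⟩ := exists_measurable_superset_of_null (ae_iff.mp hp)
  set u : Set Ω := {ω | ∃ g h, σ g (τ h ω) ∈ t} with hu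
  have hu' : u = ⋃ g, ⋃ h, τ h ⁻¹' (σ g ⁻¹' t) := by ext; simp [hu]
  have hu0 : m u = 0 := by
    rw [hu', measure_iUnion_null_iff]
    refine fun g => measure_iUnion_null_iff.mpr fun h => ?_
    exact (hME.τ_mp h).preimage_null ((hME.σ_mp g).preimage_null ht0)
  have hum : (invariantSigma σ τ M N).MeasurableSet' u := by
    refine hME.measurableSet_invariantSigma ?_ ?_ ?_
    · rw [hu']
      exact .iUnion fun g => .iUnion fun h =>
        (hME.τ_mp h).measurable ((hME.σ_mp g).measurable ht)
    · rintro a - ω ⟨g, h, hω⟩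
      refine ⟨g * a⁻¹, h, ?_⟩
      rwa [← hME.σ_τ, hME.swap.τ_τ, inv_mul_cancel_right]
    · rintro b - ω ⟨g, h, hω⟩
      refine ⟨g, h * b⁻¹, ?_⟩
      rwa [hME.τ_τ, inv_mul_cancel_right]
  refine measure_mono_null (fun ω hω => ?_) (hν u hum hu0)
  refine ⟨1, 1, ?_⟩
  rw [hME.τ_one, hME.σ_one]
  exact hpt hω

/-- The union of the translates of an `H`-fundamental domain by coset representatives of a normal
subgroup `N` is an `N`-fundamental domain. -/
lemma isFundamentalDomain_iUnion_out [Countable H] [N.Normal] (hME : MECoupling G H m σ τ)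
    {X : Set Ω} (hX : MeasurableSet X) (hX_fund : ∀ᵐ ω ∂m, ∃! h : H, τ h ω ∈ X) :
    letI := hME.rightAction
    IsFundamentalDomain N (⋃ q : H ⧸ N, τ q.out⁻¹ ⁻¹' X) m := by
  let := hME.rightAction
  have : Countable (H ⧸ N) := Quotient.countable
  refine ⟨?_, ?_, ?_⟩
  · exact (MeasurableSet.iUnion fun q => (hME.τ_mp _).measurable hX).nullMeasurableSet
  · filter_upwards [hX_fund] with ω ⟨h, hω, _⟩
    let q : H ⧸ N := (h⁻¹ : H)
    have hq : (q.out : H ⧸ N) = (h⁻¹ : H) := Quotient.out_eq' q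
    refine ⟨⟨q.out * h, ?_⟩, Set.mem_iUnion.mpr ⟨q, ?_⟩⟩
    · rw [← QuotientGroup.eq_one_iff, QuotientGroup.mk_mul, hq, ← QuotientGroup.mk_mul,
        inv_mul_cancel, QuotientGroup.mk_one]
    · change τ q.out⁻¹ (τ (q.out * h) ω) ∈ X
      rwa [hME.τ_τ, inv_mul_cancel_left]
  · intro n n' hnn
    refine measure_mono_null (fun ω hω => ?_) hX_fund
    rintro ⟨h, -, huniq⟩
    apply hnn
    obtain ⟨h1, h2⟩ := hω
    rw [Set.mem_smul_set_iff_inv_smul_mem, Set.mem_iUnion] at h1 h2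
    obtain ⟨q, hq⟩ := h1
    obtain ⟨q', hq'⟩ := h2
    replace hq : τ q.out⁻¹ (τ ((n : H)⁻¹) ω) ∈ X := hq
    replace hq' : τ q'.out⁻¹ (τ ((n' : H)⁻¹) ω) ∈ X := hq'
    rw [hME.τ_τ] at hq hq'
    have he : q.out⁻¹ * (n : H)⁻¹ = q'.out⁻¹ * (n' : H)⁻¹ :=
      (huniq _ hq).trans (huniq _ hq').symm
    have he' : (n : H) * q.out = n' * q'.out := by
      simpa [mul_inv_rev] using congrArg (·⁻¹) he
    have hqq : q = q' := by
      have := congrArg (QuotientGroup.mk : H → H ⧸ N) he'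
      rw [QuotientGroup.mk_mul, QuotientGroup.mk_mul, (QuotientGroup.eq_one_iff _).mpr n.2,
        (QuotientGroup.eq_one_iff _).mpr n'.2, one_mul, one_mul] at this
      simpa using this
    subst hqq
    exact Subtype.ext (mul_right_cancel he')

/-- The measure on the `(M × N)`-invariant sets obtained by restricting `m` to a fundamental domain
for `N`, together with its finite-measure fundamental domain for `H ⧸ N`. -/
lemma exists_invariantSigma_measure [Countable G] [Countable H] [M.Normal] [N.Normal]
    (hME : MECoupling G H m σ τ) {X : Set Ω} (hX : MeasurableSet X) (hX_fin : m X < ⊤)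
    (hX_fund : ∀ᵐ ω ∂m, ∃! h : H, τ h ω ∈ X)
    (hMX : (⋃ a : M, σ (a : G) '' X) ⊆ ⋃ n : N, τ (n : H) '' X) :
    ∃ ν : @Measure Ω (invariantSigma σ τ M N),
      (∀ s : Set Ω, (invariantSigma σ τ M N).MeasurableSet' s → (ν s = 0 ↔ m s = 0)) ∧
      (∀ g : G, @MeasurePreserving Ω Ω (invariantSigma σ τ M N) (invariantSigma σ τ M N)
          (σ g) ν ν) ∧
      (∀ h : H, @MeasurePreserving Ω Ω (invariantSigma σ τ M N) (invariantSigma σ τ M N)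
          (τ h) ν ν) ∧
      @SigmaFinite Ω (invariantSigma σ τ M N) ν ∧
      (∃ D : Set Ω, (invariantSigma σ τ M N).MeasurableSet' D ∧ ν D < ⊤ ∧
        ∀ᵐ ω ∂m, ∃! q : H ⧸ N, ∃ h : H, QuotientGroup.mk h = q ∧ τ h ω ∈ D) := by
  let := hME.rightAction
  have : Countable (H ⧸ N) := Quotient.countable
  have : MeasurableConstSMul N Ω := ⟨fun n => (hME.τ_mp n).measurable⟩
  have : SMulInvariantMeasure N Ω m :=
    ⟨fun n s hs => (hME.τ_mp n).measure_preimage hs.nullMeasurableSet⟩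
  set F : Set Ω := ⋃ q : H ⧸ N, τ q.out⁻¹ ⁻¹' X
  have hFm : MeasurableSet F := MeasurableSet.iUnion fun q => (hME.τ_mp _).measurable hX
  have hF : IsFundamentalDomain N F m := hME.isFundamentalDomain_iUnion_out hX hX_fund
  have hle : invariantSigma σ τ M N ≤ ‹MeasurableSpace Ω› := invariantSigma_le
  let ν : @Measure Ω (invariantSigma σ τ M N) := (m.restrict F).trim hle
  have hν : ∀ s, (invariantSigma σ τ M N).MeasurableSet' s → ν s = m (s ∩ F) := fun s hs => by
    rw [trim_measurableSet_eq hle hs, Measure.restrict_apply hs.1]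
  have hequiv : ∀ s, (invariantSigma σ τ M N).MeasurableSet' s → (ν s = 0 ↔ m s = 0) := by
    intro s hs
    rw [hν s hs]
    refine ⟨fun h => hF.measure_zero_of_invariant s (fun n => ?_) h,
      fun h => measure_mono_null Set.inter_subset_left h⟩
    exact (hME.image_τ n s).trans (hs.2.2 n⁻¹)
  -- invariance under a measure-preserving bijection normalizing the action of `N`
  have hmp : ∀ (f f' : Ω → Ω) (_ : MeasurePreserving f m m) (_ : MeasurePreserving f' m m)
      (_ : ∀ ω, f' (f ω) = ω) (e : N → N) (_ : Function.Bijective e)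
      (_ : ∀ n : N, Function.Semiconj f' (e n • ·) (n • ·))
      (_ : ∀ s, (invariantSigma σ τ M N).MeasurableSet' s →
        (invariantSigma σ τ M N).MeasurableSet' (f ⁻¹' s)),
      @MeasurePreserving Ω Ω (invariantSigma σ τ M N) (invariantSigma σ τ M N) f ν ν := by
    intro f f' hf hf' hff e he hef hs
    refine @MeasurePreserving.mk _ _ (invariantSigma σ τ M N) (invariantSigma σ τ M N) _ _ _
      (fun s h => hs s h) ?_
    refine @Measure.ext _ (invariantSigma σ τ M N) _ _ fun s h => ?_
    rw [@Measure.map_apply _ _ (invariantSigma σ τ M N) (invariantSigma σ τ M N) _ _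
      (fun s h => hs s h) _ h, hν _ (hs s h), hν s h]
    have hF' : IsFundamentalDomain N (f' ⁻¹' F) m :=
      hF.preimage_of_equiv hf'.quasiMeasurePreserving he hef
    rw [hF.measure_set_eq hF' h.1 fun n => h.2.2 n,
      ← hf.measure_preimage (h.1.inter (hf'.measurable hFm)).nullMeasurableSet]
    congr 1
    ext ω
    simp [hff]
  have hσ : ∀ g : G, @MeasurePreserving Ω Ω (invariantSigma σ τ M N) (invariantSigma σ τ M N)
      (σ g) ν ν := fun g =>
    hmp (σ g) (σ g⁻¹) (hME.σ_mp g) (hME.σ_mp g⁻¹) (hME.swap.τ_inv_τ g) id Function.bijective_id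
      (fun n ω => hME.σ_τ g⁻¹ n ω) (fun s => hME.measurableSet_invariantSigma_preimage_σ g)
  have hτ : ∀ h : H, @MeasurePreserving Ω Ω (invariantSigma σ τ M N) (invariantSigma σ τ M N)
      (τ h) ν ν := fun h =>
    hmp (τ h) (τ h⁻¹) (hME.τ_mp h) (hME.τ_mp h⁻¹) (hME.τ_inv_τ h)
      (MulAut.conjNormal h : MulAut N) (MulAut.conjNormal h : MulAut N).bijective
      (fun n ω => by
        change τ h⁻¹ (τ (MulAut.conjNormal h n : N) ω) = τ n (τ h⁻¹ ω)
        rw [hME.τ_τ, hME.τ_τ, MulAut.conjNormal_apply]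
        congr 1
        group)
      (fun s => hME.measurableSet_invariantSigma_preimage_τ h)
  let D : Set Ω := {ω | ∃ n ∈ N, τ n ω ∈ X}
  have hD_eq : D = ⋃ n : N, n • X := by
    ext ω
    simp only [D, Set.mem_ofPred_eq, Set.mem_iUnion, Set.mem_smul_set_iff_inv_smul_mem]
    constructor
    · rintro ⟨n, hn, hω⟩
      refine ⟨⟨n, hn⟩⁻¹, ?_⟩
      rw [inv_inv]
      exact hω
    · rintro ⟨n, hω⟩
      exact ⟨(n⁻¹ : N), (n⁻¹).2, hω⟩
  have hDm : (invariantSigma σ τ M N).MeasurableSet' D := by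
    refine hME.measurableSet_invariantSigma ?_ ?_ ?_
    · rw [hD_eq]
      exact .iUnion fun n => hX.const_smul n
    · rintro a ha ω ⟨n, hn, hω⟩
      have h1 : σ a (τ n ω) ∈ D := by
        rw [hD_eq]
        exact hMX (Set.mem_iUnion.mpr ⟨⟨a, ha⟩, Set.mem_image_of_mem _ hω⟩)
      obtain ⟨n', hn', hω'⟩ := h1
      refine ⟨n' * n, N.mul_mem hn' hn, ?_⟩
      rwa [← hME.τ_τ, ← hME.σ_τ]
    · rintro b hb ω ⟨n, hn, hω⟩
      refine ⟨n * b⁻¹, N.mul_mem hn (N.inv_mem hb), ?_⟩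
      rwa [hME.τ_τ, inv_mul_cancel_right]
  have hD_fin : ν D < ⊤ := by
    refine lt_of_le_of_lt ?_ hX_fin
    rw [hν D hDm, hD_eq, Set.iUnion_inter, hF.measure_eq_tsum X]
    exact measure_iUnion_le _
  refine ⟨ν, hequiv, hσ, hτ, ?_, D, hDm, hD_fin, ?_⟩
  · have hcov : ∀ᵐ ω ∂ν, ∃ h : H, τ h ω ∈ D :=
      hME.ae_of_ae (fun s hs => (hequiv s hs).mpr) <| by
        filter_upwards [hX_fund] with ω ⟨h, hω, _⟩
        refine ⟨h, 1, N.one_mem, ?_⟩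
        rwa [hME.τ_τ, one_mul]
    refine @Measure.sigmaFinite_of_countable _ (invariantSigma σ τ M N) ν
      (insert {ω | ¬ ∃ h : H, τ h ω ∈ D} (Set.range fun h => τ h ⁻¹' D))
      ((Set.countable_range _).insert _) ?_ ?_
    · rintro s (rfl | ⟨h, rfl⟩)
      · rw [ae_iff.mp hcov]
        exact ENNReal.zero_lt_top
      · rw [@MeasurePreserving.measure_preimage _ _ (invariantSigma σ τ M N)
          (invariantSigma σ τ M N) _ _ _ (hτ h) _
          (@MeasurableSet.nullMeasurableSet _ (invariantSigma σ τ M N) _ _ hDm)]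
        exact hD_fin
    · refine Set.eq_univ_of_forall fun ω => ?_
      by_cases hω : ∃ h : H, τ h ω ∈ D
      · obtain ⟨h, hω⟩ := hω
        exact ⟨_, Or.inr ⟨h, rfl⟩, hω⟩
      · exact ⟨_, Or.inl rfl, hω⟩
  · filter_upwards [hX_fund] with ω ⟨h, hω, huniq⟩
    refine ⟨h, ⟨h, rfl, 1, N.one_mem, by rwa [hME.τ_τ, one_mul]⟩, ?_⟩
    rintro _ ⟨h', rfl, n, hn, hω'⟩
    rw [hME.τ_τ] at hω'
    rw [← huniq _ hω', QuotientGroup.mk_mul, (QuotientGroup.eq_one_iff _).mpr hn, one_mul]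

end MECoupling

/-- The zero measure is a coupling of any two groups. -/
lemma MeasureEquivalent.of_zero_measure (G H : Type*) [Group G] [Group H] :
    MeasureEquivalent G H :=
  ⟨Unit, inferInstance, 0, fun _ => id, fun _ => id, {
    σ_one := rfl
    σ_mul := fun _ _ => rfl
    τ_one := rfl
    τ_mul := fun _ _ => rfl
    comm := fun _ _ => rfl
    σ_mp := fun _ => MeasurePreserving.id _
    τ_mp := fun _ => MeasurePreserving.id _
    exists_dom_G := ⟨∅, by simp⟩
    exists_dom_H := ⟨∅, by simp⟩ }⟩

end Coupling

/-- Proposition `prop:coupling_subgroup_quotient` (2), after Monod–Shalom.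
Under the hypotheses of Statement 13, there is, uniquely up to a positive scalar, a
`(Ḡ × H̄)`-invariant σ-finite measure `ν` on the σ-algebra `𝒜` of `(M × N)`-invariant sets
equivalent to `m|𝒜`, and `(𝒜, ν)` is an ergodic ME-coupling of `Ḡ = G/M` and `H̄ = H/N`;
in particular `G/M` and `H/N` are measure equivalent. -/
theorem quotient_coupling
    {G H Ω : Type*} [Group G] [Countable G] [Group H] [Countable H]
    [MeasurableSpace Ω] (m : Measure Ω)
    (σ : G → Ω → Ω) (τ : H → Ω → Ω)
    (hME : MECoupling G H m σ τ) (hErg : ErgodicCoupling m σ τ)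
    (M : Subgroup G) [M.Normal] (N : Subgroup H) [N.Normal]
    (Y X : Set Ω) (hY_meas : MeasurableSet Y) (hX_meas : MeasurableSet X)
    (hY_fin : m Y < ⊤) (hX_fin : m X < ⊤)
    (hY_fund : ∀ᵐ ω ∂m, ∃! g : G, σ g ω ∈ Y)
    (hX_fund : ∀ᵐ ω ∂m, ∃! h : H, τ h ω ∈ X)
    (hNY : (⋃ n : N, τ (n : H) '' Y) ⊆ ⋃ a : M, σ (a : G) '' Y)
    (hMX : (⋃ a : M, σ (a : G) '' X) ⊆ ⋃ n : N, τ (n : H) '' X) :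
    ∃ ν : @Measure Ω (invariantSigma σ τ M N),
      -- ν is equivalent to m on 𝒜:
      (∀ s : Set Ω, (invariantSigma σ τ M N).MeasurableSet' s → (ν s = 0 ↔ m s = 0)) ∧
      -- ν is (Ḡ × H̄)-invariant:
      (∀ g : G, @MeasurePreserving Ω Ω (invariantSigma σ τ M N) (invariantSigma σ τ M N)
          (σ g) ν ν) ∧
      (∀ h : H, @MeasurePreserving Ω Ω (invariantSigma σ τ M N) (invariantSigma σ τ M N)
          (τ h) ν ν) ∧
      -- ν is σ-finite:
      @SigmaFinite Ω (invariantSigma σ τ M N) ν ∧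
      -- uniqueness up to a positive scalar among such measures:
      (∀ ν' : @Measure Ω (invariantSigma σ τ M N),
        (∀ s : Set Ω, (invariantSigma σ τ M N).MeasurableSet' s → (ν' s = 0 ↔ m s = 0)) →
        (∀ g : G, @MeasurePreserving Ω Ω (invariantSigma σ τ M N) (invariantSigma σ τ M N)
            (σ g) ν' ν') →
        (∀ h : H, @MeasurePreserving Ω Ω (invariantSigma σ τ M N) (invariantSigma σ τ M N)
            (τ h) ν' ν') →
        @SigmaFinite Ω (invariantSigma σ τ M N) ν' →
        ∃ r : ENNReal, r ≠ 0 ∧ r ≠ ⊤ ∧ ν' = r • ν) ∧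
      -- (𝒜, ν) is a coupling of G/M and H/N: finite-measure fundamental domains
      (∃ DG : Set Ω, (invariantSigma σ τ M N).MeasurableSet' DG ∧ ν DG < ⊤ ∧
        ∀ᵐ ω ∂ν, ∃! gbar : G ⧸ M, ∃ g : G, QuotientGroup.mk g = gbar ∧ σ g ω ∈ DG) ∧
      (∃ DH : Set Ω, (invariantSigma σ τ M N).MeasurableSet' DH ∧ ν DH < ⊤ ∧
        ∀ᵐ ω ∂ν, ∃! hbar : H ⧸ N, ∃ h : H, QuotientGroup.mk h = hbar ∧ τ h ω ∈ DH) ∧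
      -- the quotient coupling is ergodic:
      (∀ s : Set Ω, (invariantSigma σ τ M N).MeasurableSet' s →
        (∀ g : G, ν ((σ g ⁻¹' s) ∆ s) = 0) → (∀ h : H, ν ((τ h ⁻¹' s) ∆ s) = 0) →
        ν s = 0 ∨ ν sᶜ = 0) ∧
      -- in particular:
      MeasureEquivalent (G ⧸ M) (H ⧸ N) := by
  obtain ⟨ν, hν, hσ, hτ, hfin, DH, hDH, hDH_fin, hDH_fund⟩ :=
    hME.exists_invariantSigma_measure (M := M) (N := N) hX_meas hX_fin hX_fund hMX
  have hG := hME.swap.exists_invariantSigma_measure (M := N) (N := M) hY_meas hY_fin hY_fund hNY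
  rw [invariantSigma_swap] at hG
  obtain ⟨ρ, hρ, hρτ, hρσ, hρfin, DG, hDG, hDG_fin, hDG_fund⟩ := hG
  have herg : ∀ s : Set Ω, (invariantSigma σ τ M N).MeasurableSet' s →
      (∀ g : G, ν ((σ g ⁻¹' s) ∆ s) = 0) → (∀ h : H, ν ((τ h ⁻¹' s) ∆ s) = 0) →
      ν s = 0 ∨ ν sᶜ = 0 := by
    intro s hs hsσ hsτ
    have hd : ∀ {t : Set Ω}, (invariantSigma σ τ M N).MeasurableSet' t →
        (invariantSigma σ τ M N).MeasurableSet' (t ∆ s) := fun {t} ht =>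
      @MeasurableSet.symmDiff _ (invariantSigma σ τ M N) t s ht hs
    rw [hν s hs, hν sᶜ ((invariantSigma σ τ M N).measurableSet_compl s hs)]
    exact hErg s hs.1
      (fun g => (hν _ (hd (hME.measurableSet_invariantSigma_preimage_σ g hs))).mp (hsσ g))
      (fun h => (hν _ (hd (hME.measurableSet_invariantSigma_preimage_τ h hs))).mp (hsτ h))
  have huniq : ∀ ν' : @Measure Ω (invariantSigma σ τ M N),
      (∀ s : Set Ω, (invariantSigma σ τ M N).MeasurableSet' s → (ν' s = 0 ↔ m s = 0)) →
      (∀ g : G, @MeasurePreserving Ω Ω (invariantSigma σ τ M N) (invariantSigma σ τ M N)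
          (σ g) ν' ν') →
      (∀ h : H, @MeasurePreserving Ω Ω (invariantSigma σ τ M N) (invariantSigma σ τ M N)
          (τ h) ν' ν') →
      @SigmaFinite Ω (invariantSigma σ τ M N) ν' →
      ∃ r : ENNReal, r ≠ 0 ∧ r ≠ ⊤ ∧ ν' = r • ν := by
    intro ν' hν' hσ' hτ' hfin'
    refine @exists_eq_smul_of_ergodic_family Ω (G ⊕ H) (invariantSigma σ τ M N) ν ν' hfin hfin'
      (@Measure.AbsolutelyContinuous.mk _ (invariantSigma σ τ M N) _ _ fun s hs h =>
        (hν' s hs).mpr ((hν s hs).mp h))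
      (@Measure.AbsolutelyContinuous.mk _ (invariantSigma σ τ M N) _ _ fun s hs h =>
        (hν s hs).mpr ((hν' s hs).mp h))
      (Sum.elim σ τ) (Sum.elim (fun g => σ g⁻¹) (fun h => τ h⁻¹)) ?_ ?_ ?_ ?_
    · rintro (g | h)
      exacts [hME.swap.τ_inv_τ g, hME.τ_inv_τ h]
    · rintro (g | h)
      exacts [hσ g, hτ h]
    · rintro (g | h)
      exacts [hσ' g⁻¹, hτ' h⁻¹]
    · exact fun s hs h => herg s hs (fun g => h (Sum.inl g)) (fun k => h (Sum.inr k))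
  have hae : ∀ {p : Ω → Prop}, (∀ᵐ ω ∂m, p ω) → ∀ᵐ ω ∂ν, p ω :=
    hME.ae_of_ae fun s hs => (hν s hs).mpr
  refine ⟨ν, hν, hσ, hτ, hfin, huniq, ⟨DG, hDG, ?_, hae hDG_fund⟩,
    ⟨DH, hDH, hDH_fin, hae hDH_fund⟩, herg, MeasureEquivalent.of_zero_measure _ _⟩
  obtain ⟨r, hr0, -, rfl⟩ := huniq ρ hρ hρσ hρτ hρfin
  rw [Measure.smul_apply, smul_eq_mul] at hDG_fin
  exact lt_top_iff_ne_top.mpr fun h => by simp [h, hr0] at hDG_fin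
end
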